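/- arXiv:1006.1959 — 3 statements merged into one kernel-verified Lean document; each statement's English description precedes it below -/
import Mathlib

section
/- For every integer n ≥ 1 and every j ≥ 0, the number of even-special Dyck paths of length 2n with exactly j special steps equals (1/n)·C(n,j)·C(2n−j, n+1), where C denotes the binomial coefficient. -/
/-- A Dyck path is a list of booleans: `true` is an upstep, `false` is a downstep. -/
def dyckHeight (p : List Bool) : ℤ := (p.map fun b => if b then (1 : ℤ) else -1).sum

/-- A Dyck path: ends at height 0 and never goes below the x-axis. -/
def IsDyck (p : List Bool) : Prop :=
  dyckHeight p = 0 ∧ ∀ q : List Bool, q <+: p → 0 ≤ dyckHeight q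

/-- An even-special Dyck path: a Dyck path `ps.1` together with a marked set `ps.2` of
positions of downsteps leaving from even height. -/
def IsEvenSpecial (ps : List Bool × Finset ℕ) : Prop :=
  IsDyck ps.1 ∧
    ∀ i ∈ ps.2, i < ps.1.length ∧ ps.1.getD i true = false ∧
      dyckHeight (ps.1.take i) % 2 = 0

/-- Lists of length `L` that go from height `h` to height `0` without going negative. -/
def pathsFrom : ℕ → ℕ → Finset (List Bool)
  | 0, 0 => {[]}
  | 0, _ + 1 => ∅
  | L + 1, 0 => (pathsFrom L 1).image (fun p => true :: p)
  | L + 1, h + 1 => (pathsFrom L (h + 2)).image (fun p => true :: p) ∪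
      (pathsFrom L h).image (fun p => false :: p)

lemma dyckHeight_nil : dyckHeight [] = 0 := by simp [dyckHeight]

lemma dyckHeight_cons (b : Bool) (p : List Bool) :
    dyckHeight (b :: p) = (if b then 1 else -1) + dyckHeight p := by simp [dyckHeight]

lemma nonneg_cons (b : Bool) (p : List Bool) (h : ℤ) (hh : 0 ≤ h) :
    (∀ q : List Bool, q <+: (b :: p) → 0 ≤ h + dyckHeight q) ↔
      (∀ q : List Bool, q <+: p → 0 ≤ (h + if b then 1 else -1) + dyckHeight q) := by
  constructor
  · intro H q hq
    have := H (b :: q) (by simpa [List.cons_prefix_cons] using hq)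
    rw [dyckHeight_cons] at this
    linarith
  · intro H q hq
    rcases q with _ | ⟨c, q⟩
    · simpa [dyckHeight_nil] using hh
    · rw [List.cons_prefix_cons] at hq
      obtain ⟨rfl, hq⟩ := hq
      have := H q hq
      rw [dyckHeight_cons]
      linarith

lemma mem_pathsFrom (L h : ℕ) (p : List Bool) :
    p ∈ pathsFrom L h ↔ p.length = L ∧ (h : ℤ) + dyckHeight p = 0 ∧
      ∀ q : List Bool, q <+: p → 0 ≤ (h : ℤ) + dyckHeight q := by
  induction L generalizing h p with
  | zero =>
    rcases h with _ | h
    · rcases p with _ | ⟨b, p⟩ <;> simp [pathsFrom, dyckHeight_nil]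
    · rcases p with _ | ⟨b, p⟩
      · simp [pathsFrom, dyckHeight_nil]
        intro h; omega
      · simp [pathsFrom]
  | succ L ih =>
    rcases p with _ | ⟨b, p⟩
    · rcases h with _ | h <;> simp [pathsFrom]
    · rw [nonneg_cons _ _ _ (by positivity), dyckHeight_cons]
      rcases h with _ | h
      · cases b
        · simp only [pathsFrom, Finset.mem_image]
          constructor
          · rintro ⟨a, _, ha⟩; simp at ha
          · rintro ⟨_, _, H⟩
            have := H [] (by simp)
            simp [dyckHeight_nil] at this
        · simp [pathsFrom, ih]
      · cases b
        · simp [pathsFrom, ih]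
        · simp [pathsFrom, ih]
          intro _
          have e : (h : ℤ) + 1 + 1 = h + 2 := by ring
          rw [e]
          constructor
          · rintro ⟨h1, h2⟩; exact ⟨by linarith, h2⟩
          · rintro ⟨h1, h2⟩; exact ⟨by linarith, h2⟩

lemma cons_injOn (b : Bool) (s : Set (List Bool)) :
    Set.InjOn (fun p : List Bool => b :: p) s := by
  intro x _ y _ hxy
  simpa using hxy

lemma sum_pathsFrom_zero (L : ℕ) (f : List Bool → ℤ) :
    ∑ p ∈ pathsFrom (L + 1) 0, f p = ∑ p ∈ pathsFrom L 1, f (true :: p) := by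
  rw [pathsFrom, Finset.sum_image (cons_injOn _ _)]

lemma sum_pathsFrom_succ (L h : ℕ) (f : List Bool → ℤ) :
    ∑ p ∈ pathsFrom (L + 1) (h + 1), f p =
      ∑ p ∈ pathsFrom L (h + 2), f (true :: p) + ∑ p ∈ pathsFrom L h, f (false :: p) := by
  rw [pathsFrom, Finset.sum_union, Finset.sum_image (cons_injOn _ _),
    Finset.sum_image (cons_injOn _ _)]
  rw [Finset.disjoint_left]
  intro a ha hb
  simp only [Finset.mem_image] at ha hb
  obtain ⟨x, _, rfl⟩ := ha
  obtain ⟨y, _, hy⟩ := hb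
  simp at hy

/-- Number of downsteps at even positions (`b = true`) or odd positions (`b = false`). -/
def evenDowns : Bool → List Bool → ℕ
  | _, [] => 0
  | b, x :: p => (if b && !x then 1 else 0) + evenDowns (!b) p

lemma evenDowns_le (b : Bool) (p : List Bool) : evenDowns b p ≤ p.length := by
  induction p generalizing b with
  | nil => simp [evenDowns]
  | cons x p ih =>
    have := ih (!b)
    simp only [evenDowns, List.length_cons]
    split_ifs <;> omega

lemma card_evenDowns (p : List Bool) (c : ℕ) :
    ((Finset.range p.length).filter
      (fun i => p.getD i true = false ∧ (i + c) % 2 = 0)).card =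
      evenDowns (decide (c % 2 = 0)) p := by
  induction p generalizing c with
  | nil => simp [evenDowns]
  | cons x p ih =>
    have := ih (c + 1)
    rw [Finset.card_filter] at this ⊢
    rw [List.length_cons, Finset.sum_range_succ', evenDowns]
    have e : (!decide (c % 2 = 0)) = decide ((c + 1) % 2 = 0) := by
      rcases Nat.mod_two_eq_zero_or_one c with h | h <;> simp [h, Nat.add_mod]
    rw [e, ← this, add_comm]
    congr 1
    · cases x <;> simp
    · apply Finset.sum_congr rfl
      intro i _
      simp only [List.getD_cons_succ]
      have : i + 1 + c = i + (c + 1) := by ring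
      rw [this]

lemma dyckHeight_mod (p : List Bool) : dyckHeight p % 2 = (p.length : ℤ) % 2 := by
  induction p with
  | nil => simp [dyckHeight_nil]
  | cons x p ih =>
    rw [dyckHeight_cons]
    cases x <;> simp <;> omega

/-- Binomial coefficient with integer lower index. -/
def zchoose (m : ℕ) (x : ℤ) : ℤ := if 0 ≤ x then (m.choose x.toNat : ℤ) else 0

lemma zchoose_succ (m : ℕ) (x : ℤ) :
    zchoose (m + 1) x = zchoose m x + zchoose m (x - 1) := by
  unfold zchoose
  rcases lt_trichotomy x 0 with h | h | h
  · rw [if_neg (by omega), if_neg (by omega), if_neg (by omega)]; rfl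
  · subst h; simp
  · obtain ⟨k, rfl⟩ : ∃ k : ℕ, x = k + 1 := ⟨(x - 1).toNat, by omega⟩
    rw [if_pos (by omega), if_pos (by omega), if_pos (by omega)]
    have h1 : ((k : ℤ) + 1).toNat = k + 1 := by omega
    have h2 : ((k : ℤ) + 1 - 1).toNat = k := by omega
    rw [h1, h2, Nat.choose_succ_succ]
    push_cast; ring

lemma zchoose_zero (x : ℤ) : zchoose 0 x = if x = 0 then 1 else 0 := by
  unfold zchoose
  rcases lt_trichotomy x 0 with h | h | h
  · rw [if_neg (by omega), if_neg (by omega)]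
  · subst h; simp
  · rw [if_pos (by omega), if_neg (by omega), Nat.choose_eq_zero_of_lt (by omega)]; rfl

lemma zchoose_nat (m k : ℕ) : zchoose m k = m.choose k := by simp [zchoose]

/-- Number of paths with prescribed statistic. -/
def cnt (L h : ℕ) (b : Bool) (k : ℤ) : ℤ :=
  ∑ p ∈ pathsFrom L h, if (evenDowns b p : ℤ) = k then 1 else 0

lemma cnt_zero_true (L : ℕ) (k : ℤ) : cnt (L + 1) 0 true k = cnt L 1 false k := by
  unfold cnt; rw [sum_pathsFrom_zero]; simp [evenDowns]

lemma cnt_succ_true (L h : ℕ) (k : ℤ) :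
    cnt (L + 1) (h + 1) true k = cnt L (h + 2) false k + cnt L h false (k - 1) := by
  unfold cnt; rw [sum_pathsFrom_succ]; simp only [evenDowns]
  congr 1
  · simp
  · apply Finset.sum_congr rfl
    intro p _
    apply if_congr _ rfl rfl
    simp; omega

lemma cnt_succ_false (L h : ℕ) (k : ℤ) :
    cnt (L + 1) (h + 1) false k = cnt L (h + 2) true k + cnt L h true k := by
  unfold cnt; rw [sum_pathsFrom_succ]; simp [evenDowns]

lemma cnt_formula (m h : ℕ) (k : ℤ) :
    cnt (2 * m + 1) (2 * h + 1) false k =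
      zchoose m k * zchoose m (k - h) - zchoose m (k - h - 1) * zchoose m (k + 1) := by
  induction m generalizing h k with
  | zero =>
    rw [Nat.mul_zero, cnt_succ_false]
    simp only [zchoose_zero]
    rcases h with _ | h
    · simp only [cnt, Nat.mul_zero, zero_add, pathsFrom, Finset.sum_empty, Finset.sum_singleton,
        evenDowns, Nat.cast_zero, sub_zero]
      split_ifs <;> omega
    · have : 2 * (h + 1) = (2 * h + 1) + 1 := by ring
      rw [this]
      simp [cnt, pathsFrom]
      split_ifs <;> push_cast at * <;> omega
  | succ m ih =>
    have e : 2 * (m + 1) + 1 = (2 * m + 1) + 1 + 1 := by ring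
    rw [e, cnt_succ_false]
    have e1 : 2 * h + 2 = (2 * h + 1) + 1 := by ring
    have e2 : 2 * h + 1 + 2 = 2 * (h + 1) + 1 := by ring
    rw [e1, cnt_succ_true, e2, ih, ih]
    simp only [zchoose_succ m]
    have s1 : k + 1 - 1 = k := by ring
    rcases h with _ | h
    · rw [Nat.mul_zero, cnt_zero_true]
      have := ih 0 k
      simp only [Nat.mul_zero, zero_add] at this
      rw [this]
      push_cast
      ring_nf
    · have e3 : 2 * (h + 1) = 2 * h + 1 + 1 := by ring
      rw [e3, cnt_succ_true]
      have e4 : 2 * h + 1 + 2 = 2 * (h + 1) + 1 := by ring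
      simp only [Nat.add_assoc] at *
      have h1 := ih (h + 1) k
      have h2 := ih h (k - 1)
      rw [show 2 * h + (1 + 2) = 2 * (h + 1) + 1 by ring] at *
      rw [h1, h2]
      push_cast
      ring_nf

lemma narayana (m k : ℕ) :
    ((m : ℤ) + 1) * cnt (2 * (m + 1)) 0 true k =
      ((m + 1).choose k : ℤ) * (m + 1).choose (k + 1) := by
  have e : 2 * (m + 1) = (2 * m + 1) + 1 := by ring
  rw [e, cnt_zero_true]
  have := cnt_formula m 0 k
  simp only [Nat.mul_zero, zero_add] at this
  rw [this]
  have hk1 : zchoose m ((k : ℤ) + 1) = m.choose (k + 1) := by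
    have := zchoose_nat m (k + 1); push_cast at this; exact this
  rw [← zchoose_nat (m + 1), ← zchoose_nat (m + 1)]
  push_cast
  rw [zchoose_succ, zchoose_succ]
  simp only [sub_zero, add_sub_cancel_right]
  rw [hk1, zchoose_nat]
  have r2 : ((k : ℤ) + 1) * m.choose (k + 1) = (m - k) * m.choose k := by
    rcases le_or_gt k m with h | h
    · have := Nat.choose_succ_right_eq m k
      zify [h] at this
      linarith
    · rw [Nat.choose_eq_zero_of_lt h, Nat.choose_eq_zero_of_lt (by omega)]; simp
  have r1 : (k : ℤ) * m.choose k = (m - k + 1) * zchoose m (k - 1) := by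
    rcases k with _ | k
    · simp [zchoose]
    · have e : ((k + 1 : ℕ) : ℤ) - 1 = k := by push_cast; ring
      rw [e, zchoose_nat]
      rcases le_or_gt k m with h | h
      · have := Nat.choose_succ_right_eq m k
        zify [h] at this
        push_cast
        linarith
      · rw [Nat.choose_eq_zero_of_lt h, Nat.choose_eq_zero_of_lt (by omega)]; simp
  generalize zchoose m ((k : ℤ) - 1) = a at *
  generalize (m.choose k : ℤ) = b at *
  generalize (m.choose (k + 1) : ℤ) = c at *
  linear_combination (-b - a) * r2 + (b + c) * r1

lemma vandermonde_sum (n j K : ℕ) (hn : 1 ≤ n) (hK : n ≤ K) :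
    ∑ k ∈ Finset.range K, (n.choose k * n.choose (k + 1)) * k.choose j =
      n.choose j * (2 * n - j).choose (n + 1) := by
  have h0 : ∑ k ∈ Finset.range K, (n.choose k * n.choose (k + 1)) * k.choose j =
      ∑ k ∈ Finset.range n, (n.choose k * n.choose (k + 1)) * k.choose j := by
    symm
    apply Finset.sum_subset
    · intro x; simp; omega
    · intro x _ hx
      simp at hx
      rw [Nat.choose_eq_zero_of_lt (show n < x + 1 by omega)]; simp
  rw [h0]
  rcases le_or_gt n j with hj | hj
  · rw [Nat.choose_eq_zero_of_lt (show 2 * n - j < n + 1 by omega), mul_zero]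
    apply Finset.sum_eq_zero
    intro k hk
    simp at hk
    rw [Nat.choose_eq_zero_of_lt (show k < j by omega), mul_zero]
  obtain ⟨r, rfl⟩ : ∃ r, n = j + (r + 1) := ⟨n - j - 1, by omega⟩
  rw [Finset.sum_range_add]
  rw [Finset.sum_eq_zero, zero_add]
  swap
  · intro k hk
    simp at hk
    rw [Nat.choose_eq_zero_of_lt hk, mul_zero]
  have e1 : (2 * (j + (r + 1)) - j).choose (j + (r + 1) + 1) =
      ((r + 1) + (j + (r + 1))).choose r := by
    rw [show 2 * (j + (r + 1)) - j = (r + 1) + (j + (r + 1)) by omega]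
    apply Nat.choose_symm_of_eq_add
    ring
  rw [e1, Nat.add_choose_eq (r + 1) (j + (r + 1)) r, Finset.Nat.sum_antidiagonal_eq_sum_range_succ_mk, Finset.mul_sum]
  apply Finset.sum_congr rfl
  intro i hi
  simp at hi
  have h1 := Nat.choose_mul (n := j + (r + 1)) (k := j + i) (s := j) (by omega)
  rw [show j + (r + 1) - j = r + 1 by omega, show j + i - j = i by omega] at h1
  have h2 : (j + (r + 1)).choose (j + i + 1) = (j + (r + 1)).choose (r - i) := by
    apply Nat.choose_symm_of_eq_add
    omega
  rw [h2]
  simp only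
  rw [mul_right_comm, h1, mul_assoc]

lemma card_eq_sum (n j : ℕ) :
    Nat.card {ps : List Bool × Finset ℕ //
        IsEvenSpecial ps ∧ ps.1.length = 2 * n ∧ ps.2.card = j} =
      ∑ p ∈ pathsFrom (2 * n) 0, (evenDowns true p).choose j := by
  classical
  let E : List Bool → Finset ℕ := fun p => (Finset.range p.length).filter
      (fun i => p.getD i true = false ∧ (i + 0) % 2 = 0)
  let T : Finset (Σ _ : List Bool, Finset ℕ) :=
    (pathsFrom (2 * n) 0).sigma (fun p => (E p).powersetCard j)
  have hT : T.card = ∑ p ∈ pathsFrom (2 * n) 0, (evenDowns true p).choose j := by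
    rw [Finset.card_sigma]
    apply Finset.sum_congr rfl
    intro p _
    rw [Finset.card_powersetCard]
    have := card_evenDowns p 0
    simp only [E]
    rw [this]; simp
  rw [← hT, ← Nat.card_eq_finsetCard T]
  have hmem : ∀ ps : List Bool × Finset ℕ,
      (IsEvenSpecial ps ∧ ps.1.length = 2 * n ∧ ps.2.card = j) ↔
        (⟨ps.1, ps.2⟩ : Σ _ : List Bool, Finset ℕ) ∈ T := by
    rintro ⟨p, s⟩
    simp only [T, E, Finset.mem_sigma, Finset.mem_powersetCard, mem_pathsFrom, IsEvenSpecial,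
      IsDyck, Finset.subset_iff, Finset.mem_filter, Finset.mem_range, Nat.cast_zero, zero_add,
      add_zero]
    have hpar : ∀ i, i < p.length → (dyckHeight (p.take i) % 2 = 0 ↔ i % 2 = 0) := by
      intro i hi
      rw [dyckHeight_mod, List.length_take, min_eq_left hi.le]
      omega
    constructor
    · rintro ⟨⟨⟨h1, h2⟩, h3⟩, h4, h5⟩
      exact ⟨⟨h4, h1, h2⟩, fun i hi => ⟨(h3 i hi).1, (h3 i hi).2.1,
        (hpar i (h3 i hi).1).1 (h3 i hi).2.2⟩, h5⟩
    · rintro ⟨⟨h4, h1, h2⟩, h3, h5⟩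
      exact ⟨⟨⟨h1, h2⟩, fun i hi => ⟨(h3 hi).1, (h3 hi).2.1,
        (hpar i (h3 hi).1).2 (h3 hi).2.2⟩⟩, h4, h5⟩
  exact Nat.card_congr ((Equiv.sigmaEquivProd (List Bool) (Finset ℕ)).symm.subtypeEquiv hmem)

/-- The number of even-special Dyck paths of length `2n` with exactly `j` special steps
is `(1/n) C(n,j) C(2n-j, n+1)`. -/
theorem even_special_count (n j : ℕ) (hn : 1 ≤ n) :
    (Nat.card {ps : List Bool × Finset ℕ //
        IsEvenSpecial ps ∧ ps.1.length = 2 * n ∧ ps.2.card = j} : ℚ) =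
      (1 / (n : ℚ)) * (n.choose j) * ((2 * n - j).choose (n + 1)) := by
  rw [card_eq_sum]
  have key : (n : ℤ) * ((∑ p ∈ pathsFrom (2 * n) 0, (evenDowns true p).choose j : ℕ) : ℤ) =
      (n.choose j * (2 * n - j).choose (n + 1) : ℕ) := by
    rw [← vandermonde_sum n j (2 * n + 1) hn (by omega)]
    have h1 : ((∑ p ∈ pathsFrom (2 * n) 0, (evenDowns true p).choose j : ℕ) : ℤ) =
        ∑ k ∈ Finset.range (2 * n + 1), cnt (2 * n) 0 true k * (k.choose j : ℤ) := by
      unfold cnt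
      simp only [Finset.sum_mul]
      rw [Finset.sum_comm]
      push_cast
      apply Finset.sum_congr rfl
      intro p hp
      have hl := ((mem_pathsFrom _ _ _).1 hp).1
      have := evenDowns_le true p
      rw [Finset.sum_eq_single (evenDowns true p)]
      · simp
      · intro b _ hb
        rw [if_neg (by exact_mod_cast hb.symm), zero_mul]
      · intro h; simp at h; omega
    rw [h1, Finset.mul_sum]
    push_cast
    apply Finset.sum_congr rfl
    intro k _
    obtain ⟨m, rfl⟩ : ∃ m, n = m + 1 := ⟨n - 1, by omega⟩
    have := narayana m k
    rw [← this]
    push_cast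
    ring
  have hn' : (n : ℚ) ≠ 0 := by positivity
  have key' : (n : ℚ) * ((∑ p ∈ pathsFrom (2 * n) 0, (evenDowns true p).choose j : ℕ) : ℚ) =
      (n.choose j * (2 * n - j).choose (n + 1) : ℕ) := by exact_mod_cast key
  rw [mul_assoc, one_div, eq_inv_mul_iff_mul_eq₀ hn', key']
  push_cast
  rfl
end

section
/- For every integer n ≥ 1 and every j with 0 ≤ j ≤ n, the number of odd-special Dyck paths of length 2n with exactly j special steps equals (1/(n−j+1))·C(n,j)·C(2n−j, n), where C denotes the binomial coefficient. -/
/-- An odd-special Dyck path: a Dyck path `ps.1` together with a marked set `ps.2` of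
positions of downsteps leaving from odd height. -/
def IsOddSpecial (ps : List Bool × Finset ℕ) : Prop :=
  IsDyck ps.1 ∧
    ∀ i ∈ ps.2, i < ps.1.length ∧ ps.1.getD i true = false ∧
      dyckHeight (ps.1.take i) % 2 = 1

/-- all prefixes are nonnegative -/
def OSNN (p : List Bool) : Prop := ∀ q : List Bool, q <+: p → 0 ≤ dyckHeight q

/-- the marks are legal -/
def OSMk (p : List Bool) (s : Finset ℕ) : Prop :=
  ∀ i ∈ s, i < p.length ∧ p.getD i true = false ∧ dyckHeight (p.take i) % 2 = 1

lemma os_height_append (q : List Bool) (b : Bool) :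
    dyckHeight (q ++ [b]) = dyckHeight q + if b then 1 else -1 := by
  simp [dyckHeight]

lemma os_nn_append (q : List Bool) (b : Bool) :
    OSNN (q ++ [b]) ↔ OSNN q ∧ 0 ≤ dyckHeight (q ++ [b]) := by
  unfold OSNN
  constructor
  · intro h
    exact ⟨fun r hr => h r (hr.trans (List.prefix_append _ _)), h _ (List.prefix_refl _)⟩
  · rintro ⟨h1, h2⟩ r hr
    rcases List.prefix_concat_iff.1 hr with rfl | hr
    · simpa using h2
    · exact h1 r hr

lemma os_mk_append (q : List Bool) (b : Bool) (s : Finset ℕ) :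
    OSMk (q ++ [b]) s ↔ OSMk q (s.erase q.length) ∧
      (q.length ∈ s → b = false ∧ dyckHeight q % 2 = 1) := by
  have key : ∀ i, i < q.length → ((q ++ [b]).getD i true = q.getD i true ∧
      (q ++ [b]).take i = q.take i) := by
    intro i hi
    refine ⟨?_, ?_⟩
    · simp [List.getD, List.getElem?_append_left hi]
    · rw [List.take_append_of_le_length hi.le]
  unfold OSMk
  constructor
  · intro h
    refine ⟨fun i hi => ?_, fun hm => ?_⟩
    · rw [Finset.mem_erase] at hi
      obtain ⟨h1, h2, h3⟩ := h i hi.2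
      have hlt : i < q.length := by
        simp at h1; omega
      obtain ⟨k1, k2⟩ := key i hlt
      exact ⟨hlt, k1 ▸ h2, k2 ▸ h3⟩
    · obtain ⟨h1, h2, h3⟩ := h _ hm
      simp at h2 h3
      exact ⟨h2, h3⟩
  · rintro ⟨h1, h2⟩ i hi
    by_cases hq : i = q.length
    · subst hq
      obtain ⟨a, c⟩ := h2 hi
      simp [a, c]
    · obtain ⟨a1, a2, a3⟩ := h1 i (Finset.mem_erase.2 ⟨hq, hi⟩)
      obtain ⟨k1, k2⟩ := key i a1
      refine ⟨by simp; omega, by rw [k1]; exact a2, by rw [k2]; exact a3⟩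

/-- append an unmarked step -/
def osApp (b : Bool) (x : List Bool × Finset ℕ) : List Bool × Finset ℕ := (x.1 ++ [b], x.2)

/-- append a marked downstep -/
def osMark (x : List Bool × Finset ℕ) : List Bool × Finset ℕ :=
  (x.1 ++ [false], insert x.1.length x.2)

/-- marked prefixes of length `m`, final height `h`, with `j` marks -/
def osT : ℕ → ℕ → ℕ → Finset (List Bool × Finset ℕ)
  | 0, h, j => if h = 0 ∧ j = 0 then {([], ∅)} else ∅
  | m + 1, h, j =>
    (if 1 ≤ h then (osT m (h - 1) j).image (osApp true) else ∅) ∪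
    ((osT m (h + 1) j).image (osApp false) ∪
     (if h % 2 = 0 ∧ 1 ≤ j then (osT m (h + 1) (j - 1)).image osMark else ∅))

lemma os_mem (m : ℕ) : ∀ (h j : ℕ) (p : List Bool) (s : Finset ℕ), (p, s) ∈ osT m h j ↔
    p.length = m ∧ OSNN p ∧ dyckHeight p = h ∧ OSMk p s ∧ s.card = j := by
  induction m with
  | zero =>
    intro h j p s
    simp only [osT]
    constructor
    · intro hh
      split_ifs at hh with hc
      · simp at hh
        obtain ⟨rfl, rfl⟩ := hh
        obtain ⟨rfl, rfl⟩ := hc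
        simp [OSNN, OSMk, dyckHeight]
      · simp at hh
    · rintro ⟨h1, h2, h3, h4, h5⟩
      have : p = [] := List.length_eq_zero_iff.1 h1
      subst this
      have hs : s = ∅ := by
        apply Finset.eq_empty_of_forall_notMem
        intro i hi
        simpa using (h4 i hi).1
      subst hs
      simp [dyckHeight] at h3 h5
      have : h = 0 := by omega
      simp [this, h5.symm]
  | succ m ih =>
    intro h j p s
    simp only [osT, Finset.mem_union]
    constructor
    · rintro (hh | hh | hh)
      · split_ifs at hh with hc
        · obtain ⟨⟨q, t⟩, hq, he⟩ := Finset.mem_image.1 hh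
          simp only [osApp, Prod.mk.injEq] at he
          obtain ⟨rfl, rfl⟩ := he
          obtain ⟨h1, h2, h3, h4, h5⟩ := (ih _ _ _ _).1 hq
          have hn : q.length ∉ t := fun hx => absurd (h4 _ hx).1 (lt_irrefl _)
          rw [os_nn_append, os_mk_append, Finset.erase_eq_of_notMem hn, os_height_append]
          refine ⟨by simp [h1], ⟨h2, ?_⟩, ?_, ⟨h4, fun hx => absurd hx hn⟩, h5⟩
          · simp; omega
          · simp; omega
        · simp at hh
      · obtain ⟨⟨q, t⟩, hq, he⟩ := Finset.mem_image.1 hh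
        simp only [osApp, Prod.mk.injEq] at he
        obtain ⟨rfl, rfl⟩ := he
        obtain ⟨h1, h2, h3, h4, h5⟩ := (ih _ _ _ _).1 hq
        have hn : q.length ∉ t := fun hx => absurd (h4 _ hx).1 (lt_irrefl _)
        rw [os_nn_append, os_mk_append, Finset.erase_eq_of_notMem hn, os_height_append]
        refine ⟨by simp [h1], ⟨h2, ?_⟩, ?_, ⟨h4, fun hx => absurd hx hn⟩, h5⟩
        · simp; omega
        · simp; omega
      · split_ifs at hh with hc
        · obtain ⟨⟨q, t⟩, hq, he⟩ := Finset.mem_image.1 hh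
          simp only [osMark, Prod.mk.injEq] at he
          obtain ⟨rfl, rfl⟩ := he
          obtain ⟨h1, h2, h3, h4, h5⟩ := (ih _ _ _ _).1 hq
          have hn : q.length ∉ t := fun hx => absurd (h4 _ hx).1 (lt_irrefl _)
          rw [os_nn_append, os_mk_append, Finset.erase_insert hn, os_height_append,
            Finset.card_insert_of_notMem hn]
          refine ⟨by simp [h1], ⟨h2, ?_⟩, ?_, ⟨h4, fun hx => ⟨rfl, ?_⟩⟩, ?_⟩
          · simp; omega
          · simp; omega
          · omega
          · omega
        · simp at hh
    · rintro ⟨h1, h2, h3, h4, h5⟩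
      rcases List.eq_nil_or_concat p with rfl | ⟨q, b, rfl⟩
      · simp at h1
      rw [List.concat_eq_append] at *
      rw [os_nn_append] at h2
      rw [os_mk_append] at h4
      rw [os_height_append] at h3 h2
      have hl : q.length = m := by simpa using h1
      have hq0 : 0 ≤ dyckHeight q := h2.1 q (List.prefix_refl _)
      by_cases hm : q.length ∈ s
      · obtain ⟨rfl, ho⟩ := h4.2 hm
        simp at h3 h2
        right; right
        have hj1 : 1 ≤ j := by rw [← h5]; exact Finset.card_pos.2 ⟨_, hm⟩
        rw [if_pos ⟨by omega, hj1⟩]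
        refine Finset.mem_image.2 ⟨(q, s.erase q.length), (ih _ _ _ _).2
          ⟨hl, h2.1, by push_cast; omega, h4.1, ?_⟩, ?_⟩
        · rw [Finset.card_erase_of_mem hm, h5]
        · simp [osMark, Finset.insert_erase hm]
      · rw [Finset.erase_eq_of_notMem hm] at h4
        cases b
        · simp at h3 h2
          right; left
          exact Finset.mem_image.2 ⟨(q, s), (ih _ _ _ _).2
            ⟨hl, h2.1, by push_cast; omega, h4.1, h5⟩, rfl⟩
        · simp at h3 h2
          left
          rw [if_pos (by omega)]
          exact Finset.mem_image.2 ⟨(q, s), (ih _ _ _ _).2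
            ⟨hl, h2.1, by omega, h4.1, h5⟩, rfl⟩

lemma osApp_inj (b : Bool) : Function.Injective (osApp b) := by
  rintro ⟨p, s⟩ ⟨q, t⟩ h
  simpa [osApp] using h

lemma osMark_card (m h j : ℕ) : ((osT m h j).image osMark).card = (osT m h j).card := by
  apply Finset.card_image_of_injOn
  rintro ⟨p, s⟩ hp ⟨q, t⟩ hq h
  obtain ⟨h1, -, -, h4, -⟩ := (os_mem _ _ _ _ _).1 hp
  obtain ⟨k1, -, -, k4, -⟩ := (os_mem _ _ _ _ _).1 hq
  have hn : p.length ∉ s := fun hx => absurd (h4 _ hx).1 (lt_irrefl _)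
  have kn : q.length ∉ t := fun hx => absurd (k4 _ hx).1 (lt_irrefl _)
  simp only [osMark, Prod.mk.injEq, List.append_cancel_right_eq] at h
  obtain ⟨rfl, h⟩ := h
  have := congrArg (fun u => u.erase p.length) h
  simp only [Finset.erase_insert hn, Finset.erase_insert kn] at this
  rw [this]

lemma osT_card (m h j : ℕ) : (osT (m + 1) h j).card =
    (if 1 ≤ h then (osT m (h - 1) j).card else 0) + ((osT m (h + 1) j).card +
     (if h % 2 = 0 ∧ 1 ≤ j then (osT m (h + 1) (j - 1)).card else 0)) := by
  rw [osT, Finset.card_union_of_disjoint, Finset.card_union_of_disjoint,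
    Finset.card_image_of_injective _ (osApp_inj false)]
  · congr 1
    · split_ifs
      · rw [Finset.card_image_of_injective _ (osApp_inj true)]
      · rfl
    · congr 1
      split_ifs
      · rw [osMark_card]
      · rfl
  · rw [Finset.disjoint_left]
    intro x hx hy
    split_ifs at hy
    · obtain ⟨⟨q, t⟩, hq, rfl⟩ := Finset.mem_image.1 hx
      obtain ⟨⟨q', t'⟩, hq', he⟩ := Finset.mem_image.1 hy
      obtain ⟨h1, -, -, h4, -⟩ := (os_mem _ _ _ _ _).1 hq
      have hn : q.length ∉ t := fun hx => absurd (h4 _ hx).1 (lt_irrefl _)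
      simp only [osMark, osApp, Prod.mk.injEq, List.append_cancel_right_eq] at he
      obtain ⟨rfl, rfl⟩ := he
      simp at hn
    · simp at hy
  · rw [Finset.disjoint_left]
    intro x hx hy
    split_ifs at hx
    · obtain ⟨⟨q, t⟩, hq, rfl⟩ := Finset.mem_image.1 hx
      rcases Finset.mem_union.1 hy with hy | hy
      · obtain ⟨⟨q', t'⟩, hq', he⟩ := Finset.mem_image.1 hy
        simp [osApp] at he
      · split_ifs at hy
        · obtain ⟨⟨q', t'⟩, hq', he⟩ := Finset.mem_image.1 hy
          simp [osApp, osMark] at he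
        · simp at hy
    · simp at hx

/-- closed form, `N = M+1` -/
def osC (N k j : ℕ) : ℚ := (k : ℚ) / N * (N.choose j) * ((2 * N - j).choose (N + k))

lemma os_choose_rel (M a : ℕ) :
    ((a : ℚ) + 1) * (M.choose (a + 1)) = ((M : ℚ) - a) * (M.choose a) := by
  rcases le_or_gt a M with h | h
  · have := Nat.choose_succ_right_eq M a
    have h2 : ((M.choose (a + 1) * (a + 1) : ℕ) : ℚ) = ((M.choose a * (M - a) : ℕ) : ℚ) := by
      rw [this]
    push_cast [Nat.cast_sub h] at h2
    linarith
  · rw [Nat.choose_eq_zero_of_lt h, Nat.choose_eq_zero_of_lt (by omega)]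
    simp

lemma osC_rec_zero (N k : ℕ) (hN : 1 ≤ N) : osC (N + 1) (k + 1) 0 =
    osC N k 0 + 2 * osC N (k + 1) 0 + osC N (k + 2) 0 := by
  unfold osC
  obtain ⟨a, ha⟩ : ∃ a, a = N + k := ⟨_, rfl⟩
  have e1 : 2 * (N + 1) - 0 = 2 * N + 1 + 1 := by omega
  have e2 : N + 1 + (k + 1) = a + 1 + 1 := by omega
  have e3 : N + (k + 1) = a + 1 := by omega
  have e4 : N + (k + 2) = a + 1 + 1 := by omega
  have hk : (k : ℚ) = a - N := by rw [ha]; push_cast; ring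
  rw [e1, e2, e3, e4, ← ha, Nat.sub_zero, Nat.choose_succ_succ (2 * N + 1),
    Nat.choose_succ_succ (2 * N) a, Nat.choose_succ_succ (2 * N) (a + 1)]
  have r1 := os_choose_rel (2 * N) a
  have r2 := os_choose_rel (2 * N) (a + 1)
  simp only [Nat.choose_zero_right]
  have hN' : (N : ℚ) ≠ 0 := by positivity
  have hN1 : (N : ℚ) + 1 ≠ 0 := by positivity
  have ha1 : (a : ℚ) + 1 ≠ 0 := by positivity
  have ha2 : (a : ℚ) + 2 ≠ 0 := by positivity
  push_cast at r1 r2 ⊢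
  rw [hk]
  generalize ((2 * N).choose a : ℚ) = b0 at *
  generalize ((2 * N).choose (a + 1) : ℚ) = b1 at *
  generalize ((2 * N).choose (a + 1 + 1) : ℚ) = b2 at *
  have s1 : b1 = (2 * N - a) * b0 / (a + 1) := by field_simp; linarith
  have s2 : b2 = (2 * N - a - 1) * b1 / (a + 2) := by field_simp; linarith
  rw [s2, s1]
  field_simp
  ring

lemma osC_rec_succ (N k j : ℕ) (hN : 1 ≤ N) : osC (N + 1) (k + 1) (j + 1) =
    osC N k (j + 1) + 2 * osC N (k + 1) (j + 1) + osC N (k + 2) (j + 1)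
      + osC N (k + 1) j + osC N (k + 2) j := by
  unfold osC
  rcases lt_or_ge N j with hj | hj
  · rw [Nat.choose_eq_zero_of_lt hj, Nat.choose_eq_zero_of_lt (by omega : N < j + 1),
      Nat.choose_eq_zero_of_lt (by omega : N + 1 < j + 1)]
    simp
  obtain ⟨a, ha⟩ : ∃ a, a = N + k := ⟨_, rfl⟩
  obtain ⟨M, hM⟩ : ∃ M, 2 * N = M + (j + 1) := ⟨2 * N - (j + 1), by omega⟩
  have e1 : 2 * (N + 1) - (j + 1) = M + 1 + 1 := by omega
  have e2 : N + 1 + (k + 1) = a + 1 + 1 := by omega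
  have e3 : N + (k + 1) = a + 1 := by omega
  have e4 : N + (k + 2) = a + 1 + 1 := by omega
  have e5 : 2 * N - (j + 1) = M := by omega
  have e6 : 2 * N - j = M + 1 := by omega
  have hk : (k : ℚ) = a - N := by rw [ha]; push_cast; ring
  have hMq : (M : ℚ) = 2 * N - j - 1 := by
    have : ((2 * N : ℕ) : ℚ) = ((M + (j + 1) : ℕ) : ℚ) := by rw [hM]
    push_cast at this
    linarith
  rw [e1, e2, e3, e4, e5, e6, ← ha, Nat.choose_succ_succ (M + 1),
    Nat.choose_succ_succ M a, Nat.choose_succ_succ M (a + 1), Nat.choose_succ_succ N j]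
  have r1 := os_choose_rel M a
  have r2 := os_choose_rel M (a + 1)
  have r3 := os_choose_rel N j
  have hN' : (N : ℚ) ≠ 0 := by positivity
  have hN1 : (N : ℚ) + 1 ≠ 0 := by positivity
  have ha1 : (a : ℚ) + 1 ≠ 0 := by positivity
  have ha2 : (a : ℚ) + 2 ≠ 0 := by positivity
  have hj1 : (j : ℚ) + 1 ≠ 0 := by positivity
  push_cast at r1 r2 r3 ⊢
  rw [hMq] at r1 r2
  rw [hk]
  generalize (M.choose a : ℚ) = b0 at *
  generalize (M.choose (a + 1) : ℚ) = b1 at *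
  generalize (M.choose (a + 1 + 1) : ℚ) = b2 at *
  generalize (N.choose j : ℚ) = c0 at *
  generalize (N.choose (j + 1) : ℚ) = c1 at *
  have s1 : b1 = (2 * N - j - 1 - a) * b0 / (a + 1) := by field_simp; linarith
  have s2 : b2 = (2 * N - j - 1 - a - 1) * b1 / (a + 2) := by field_simp; linarith
  have s3 : c1 = (N - j) * c0 / (j + 1) := by field_simp; linarith
  rw [s2, s1, s3]
  field_simp
  ring

lemma os_count (N : ℕ) : ∀ k j, ((osT (2 * N + 1) (2 * k + 1) j).card : ℚ)
    = osC (N + 1) (k + 1) j := by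
  induction N with
  | zero =>
    intro k j
    rw [osT_card]
    simp only [osT, osC]
    rcases k with _ | k
    · rcases j with _ | _ | j
      · simp
      · simp
      · simp [Nat.choose_eq_zero_of_lt]
    · have : (2 * (0 + 1) - j).choose (0 + 1 + (k + 1 + 1)) = 0 :=
        Nat.choose_eq_zero_of_lt (by omega)
      rw [this]
      simp
  | succ N ih =>
    intro k j
    have e1 : 2 * (N + 1) + 1 = (2 * N + 1) + 1 + 1 := by ring
    have o : ¬ ((2 * k + 1) % 2 = 0 ∧ 1 ≤ j) := by omega
    have hz : osC (N + 1) 0 j = 0 := by simp [osC]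
    have hk : ((if 1 ≤ 2 * k then (osT (2 * N + 1) (2 * k - 1) j).card else 0 : ℕ) : ℚ)
        = osC (N + 1) k j := by
      rcases k with _ | k
      · simp [hz]
      · rw [if_pos (by omega), ← ih]
        congr 3
    rw [e1, osT_card, if_pos (by omega), if_neg o, Nat.add_sub_cancel, osT_card _ (2 * k), osT_card _ (2 * k + 1 + 1),
      if_pos (by omega : 1 ≤ 2 * k + 1 + 1), show 2 * k + 1 + 1 + 1 = 2 * (k + 1) + 1 by ring,
      Nat.add_sub_cancel]
    simp only [Nat.cast_add, hk, ih]
    rcases j with _ | j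
    · rw [osC_rec_zero (N + 1) k (by omega)]
      simp
      ring
    · rw [osC_rec_succ (N + 1) k j (by omega)]
      rw [if_pos (⟨by omega, by omega⟩ : 2 * k % 2 = 0 ∧ 1 ≤ j + 1),
        if_pos (⟨by omega, by omega⟩ : (2 * k + 1 + 1) % 2 = 0 ∧ 1 ≤ j + 1),
        Nat.add_sub_cancel, ih, ih]
      push_cast
      ring

lemma os_final (n j : ℕ) (hn : 1 ≤ n) (hj : j ≤ n) : ((osT (2 * n) 0 j).card : ℚ) =
      (1 / ((n : ℚ) - j + 1)) * (n.choose j) * ((2 * n - j).choose n) := by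
  obtain ⟨N, hN⟩ : ∃ N, n = N + 1 := ⟨n - 1, by omega⟩
  have c : ∀ j, ((osT (2 * N + 1) 1 j).card : ℚ) = osC n 1 j := by
    intro j
    rw [hN]
    exact os_count N 0 j
  have hstep := osT_card (2 * N + 1) 0 j
  rw [show 2 * N + 1 + 1 = 2 * n by omega, if_neg (by omega), zero_add, zero_add] at hstep
  rw [hstep]
  push_cast
  rw [c]
  have hn0 : (n : ℚ) ≠ 0 := by positivity
  have hn1 : (n : ℚ) + 1 ≠ 0 := by positivity
  rcases j with _ | j
  · have r := os_choose_rel (2 * n) n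
    simp [osC]
    push_cast at r
    field_simp
    linarith
  · rw [if_pos (⟨trivial, by omega⟩ : True ∧ 1 ≤ j + 1), Nat.add_sub_cancel, c]
    unfold osC
    obtain ⟨M, hM⟩ : ∃ M, 2 * n = M + (j + 1) := ⟨2 * n - (j + 1), by omega⟩
    have e5 : 2 * n - (j + 1) = M := by omega
    have e6 : 2 * n - j = M + 1 := by omega
    have hMq : (M : ℚ) = 2 * n - j - 1 := by
      have : ((2 * n : ℕ) : ℚ) = ((M + (j + 1) : ℕ) : ℚ) := by rw [hM]
      push_cast at this
      linarith
    have hnj : (n : ℚ) - j ≠ 0 := by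
      have : (j : ℚ) + 1 ≤ n := by exact_mod_cast hj
      intro h
      linarith
    have hj1 : (j : ℚ) + 1 ≠ 0 := by positivity
    rw [e5, e6, Nat.choose_succ_succ M n]
    have r1 := os_choose_rel M n
    have r3 := os_choose_rel n j
    push_cast
    rw [hMq] at r1
    rw [show (n : ℚ) - (j + 1) + 1 = n - j by ring]
    generalize (M.choose n : ℚ) = b0 at *
    generalize (M.choose (n + 1) : ℚ) = b1 at *
    generalize (n.choose j : ℚ) = c0 at *
    generalize (n.choose (j + 1) : ℚ) = c1 at *
    have s1 : b1 = (2 * n - j - 1 - n) * b0 / (n + 1) := by field_simp; linarith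
    have s3 : c1 = (n - j) * c0 / (j + 1) := by field_simp; linarith
    rw [s1, s3]
    field_simp
    ring

/-- The number of odd-special Dyck paths of length `2n` with exactly `j` special steps
is `(1/(n-j+1)) C(n,j) C(2n-j, n)`. -/
theorem odd_special_count (n j : ℕ) (hn : 1 ≤ n) (hj : j ≤ n) :
    (Nat.card {ps : List Bool × Finset ℕ //
        IsOddSpecial ps ∧ ps.1.length = 2 * n ∧ ps.2.card = j} : ℚ) =
      (1 / ((n : ℚ) - j + 1)) * (n.choose j) * ((2 * n - j).choose n) := by
  rw [← os_final n j hn hj]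
  congr 1
  apply Nat.subtype_card
  rintro ⟨p, s⟩
  rw [os_mem]
  simp only [IsOddSpecial, IsDyck, OSNN, OSMk]
  push_cast
  tauto
end

section
/- For all integers n ≥ 1 and j ≥ 0, the binomial identity Σ_{k ≥ 0} N(n,k)·C(k,j) = (1/n)·C(n,j)·C(2n−j, n+1) holds, where N(n,k) = (1/n)·C(n,k)·C(n,k+1) is the Narayana number and C denotes the binomial coefficient. -/
theorem narayana_aux (n j : ℕ) :
    ∑ k ∈ Finset.range (n + 1), n.choose k * n.choose (k + 1) * k.choose j =
      n.choose j * (2 * n - j).choose (n + 1) := by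
  rcases lt_or_ge n j with h | h
  · rw [Nat.choose_eq_zero_of_lt h, zero_mul]
    refine Finset.sum_eq_zero fun k hk => ?_
    rw [Finset.mem_range] at hk
    rw [Nat.choose_eq_zero_of_lt (show k < j by omega), mul_zero]
  · have e : 2 * n - j = n + (n - j) := by omega
    rw [e, Nat.add_choose_eq, Finset.Nat.sum_antidiagonal_eq_sum_range_succ_mk]
    conv_rhs => rw [Finset.sum_range_succ']
    have h0 : (n - j).choose (n + 1 - 0) = 0 := Nat.choose_eq_zero_of_lt (by omega)
    simp only [h0, mul_zero, add_zero]
    rw [Finset.mul_sum]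
    refine Finset.sum_congr rfl fun k hk => ?_
    rw [Finset.mem_range] at hk
    have e2 : n + 1 - (k + 1) = n - k := by omega
    rw [e2]
    rcases lt_or_ge k j with hkj | hkj
    · rw [Nat.choose_eq_zero_of_lt hkj, Nat.choose_eq_zero_of_lt (show n - j < n - k by omega)]
      simp
    · have h1 := Nat.choose_mul (n := n) hkj
      have h2 : (n - j).choose (k - j) = (n - j).choose (n - k) := by
        apply Nat.choose_symm_of_eq_add
        omega
      rw [h2] at h1
      calc _ = (n.choose k * k.choose j) * n.choose (k + 1) := by ring
        _ = _ := by rw [h1]; ring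

/-- The binomial identity `∑_{k ≥ 0} N(n,k) C(k,j) = (1/n) C(n,j) C(2n-j, n+1)`, where
`N(n,k) = (1/n) C(n,k) C(n,k+1)` is the Narayana number. -/
theorem narayana_sum_choose (n j : ℕ) (hn : 1 ≤ n) :
    (∑ᶠ k : ℕ, (1 / (n : ℚ)) * (n.choose k) * (n.choose (k + 1)) * (k.choose j)) =
      (1 / (n : ℚ)) * (n.choose j) * ((2 * n - j).choose (n + 1)) := by
  rw [finsum_eq_sum_of_support_subset (s := Finset.range (n + 1))]
  · have h := congrArg (fun x : ℕ => (1 / (n : ℚ)) * (x : ℚ)) (narayana_aux n j)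
    simp only [Nat.cast_sum, Nat.cast_mul, Finset.mul_sum] at h
    simpa only [mul_assoc] using h
  · intro k hk
    by_contra hc
    simp only [Finset.coe_range, Set.mem_Iio, not_lt] at hc
    apply hk
    simp [Nat.choose_eq_zero_of_lt (show n < k by omega)]
end
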